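/- With I(α) = ∫₀¹ r^α e^{-1/r} dr, for every integer j ≥ 2 and every real p with p > 2 + 2/j, the quantity [I(-2jk+3)]^p · I(-(j+1)pk+3) / ( [I(-2(j+1)k+3)]^p · I(-(j-1)pk+3) ) tends to +∞ as the positive integer k tends to infinity. -/

import Mathlib

open MeasureTheory Filter

/-- `I(α) = ∫₀¹ r^α e^{-1/r} dr`. -/
noncomputable def Iw (α : ℝ) : ℝ := ∫ r in Set.Ioo (0:ℝ) 1, r ^ α * Real.exp (-(1/r))

theorem rpow_neg_mul_exp_neg_inv_le {a r : ℝ} (ha : 0 < a) (hr : 0 < r) :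
    r ^ (-a) * Real.exp (-(1 / r)) ≤ Real.exp (a * Real.log a - a) := by
  rw [Real.rpow_def_of_pos hr, ← Real.exp_add, Real.exp_le_exp]
  have h := Real.log_le_sub_one_of_pos (show 0 < 1 / (r * a) by positivity)
  rw [one_div, Real.log_inv, Real.log_mul hr.ne' ha.ne'] at h
  have h2 := mul_le_mul_of_nonneg_left h ha.le
  have h3 : a * ((r * a)⁻¹ - 1) = 1 / r - a := by field_simp
  linarith

theorem Iw_integrand_bound {a r : ℝ} (ha : 0 < a) (hr : r ∈ Set.Ioo (0 : ℝ) 1) :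
    ‖r ^ (-a + 3) * Real.exp (-(1 / r))‖ ≤ Real.exp (a * Real.log a - a) := by
  obtain ⟨h0, h1⟩ := hr
  rw [Real.norm_of_nonneg (by positivity), Real.rpow_add h0]
  have h3 : r ^ (3 : ℝ) ≤ 1 := Real.rpow_le_one h0.le h1.le (by norm_num)
  calc r ^ (-a) * r ^ (3 : ℝ) * Real.exp (-(1 / r))
      = r ^ (-a) * Real.exp (-(1 / r)) * r ^ (3 : ℝ) := by ring
    _ ≤ r ^ (-a) * Real.exp (-(1 / r)) * 1 := by gcongr
    _ ≤ _ := by simpa using rpow_neg_mul_exp_neg_inv_le ha h0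

theorem Iw_le {a : ℝ} (ha : 0 < a) : Iw (-a + 3) ≤ Real.exp (a * Real.log a - a) := by
  refine (Real.le_norm_self _).trans ?_
  have h := norm_setIntegral_le_of_norm_le_const (μ := volume) (s := Set.Ioo (0 : ℝ) 1)
    (f := fun r : ℝ => r ^ (-a + 3) * Real.exp (-(1 / r))) (by simp)
    (fun r hr => Iw_integrand_bound ha hr)
  simpa [Iw] using h

theorem integrableOn_Iw_integrand {a : ℝ} (ha : 0 < a) :
    IntegrableOn (fun r : ℝ => r ^ (-a + 3) * Real.exp (-(1 / r))) (Set.Ioo 0 1) := by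
  refine Measure.integrableOn_of_bounded (M := Real.exp (a * Real.log a - a)) (by simp) ?_ ?_
  · exact (by fun_prop : Measurable fun r : ℝ =>
      r ^ (-a + 3) * Real.exp (-(1 / r))).aestronglyMeasurable
  · exact (ae_restrict_iff' measurableSet_Ioo).2 (ae_of_all _ fun r hr => Iw_integrand_bound ha hr)

theorem le_Iw {a : ℝ} (ha : 1 ≤ a) :
    Real.exp (a * Real.log a - a - 1 - 5 * Real.log (a + 1)) ≤ Iw (-a + 3) := by
  have ha0 : 0 < a := by linarith
  have hsub : Set.Ioo (1 / (a + 1)) (1 / a) ⊆ Set.Ioo (0 : ℝ) 1 := by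
    refine Set.Ioo_subset_Ioo (by positivity) ?_
    rw [div_le_one ha0]; exact ha
  have hint := integrableOn_Iw_integrand ha0
  have hlen : 1 / (a + 1) < 1 / a := one_div_lt_one_div_of_lt ha0 (by linarith)
  have hmono : ∫ r in Set.Ioo (1 / (a + 1)) (1 / a), r ^ (-a + 3) * Real.exp (-(1 / r)) ≤
      Iw (-a + 3) := by
    refine setIntegral_mono_set hint ?_ hsub.eventuallyLE
    refine (ae_restrict_iff' measurableSet_Ioo).2 (ae_of_all _ fun r hr => ?_)
    have := hr.1
    simp only [Pi.zero_apply]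
    positivity
  refine le_trans ?_ hmono
  have hconst : ∀ r ∈ Set.Ioo (1 / (a + 1)) (1 / a),
      Real.exp (a * Real.log a - a - 1 - 3 * Real.log (a + 1)) ≤
        r ^ (-a + 3) * Real.exp (-(1 / r)) := by
    rintro r ⟨h1, h2⟩
    have h0 : 0 < r := lt_trans (by positivity) h1
    rw [Real.rpow_def_of_pos h0, ← Real.exp_add, Real.exp_le_exp]
    have e1 : 1 / r ≤ a + 1 := by
      rw [div_le_iff₀ h0]; rw [div_lt_iff₀ (by linarith)] at h1; linarith
    have e2 : Real.log r ≤ -Real.log a := by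
      rw [← Real.log_inv, ← one_div]; exact Real.log_le_log h0 h2.le
    have e3 : -Real.log (a + 1) ≤ Real.log r := by
      rw [← Real.log_inv, ← one_div]; exact Real.log_le_log (by positivity) h1.le
    nlinarith [mul_le_mul_of_nonneg_left e2 ha0.le]
  have h := setIntegral_ge_of_const_le_real measurableSet_Ioo (by simp) hconst (hint.mono_set hsub)
  refine le_trans ?_ h
  rw [Measure.real, Real.volume_Ioo, ENNReal.toReal_ofReal (by linarith)]
  have e : Real.exp (a * Real.log a - a - 1 - 5 * Real.log (a + 1)) =
      Real.exp (a * Real.log a - a - 1 - 3 * Real.log (a + 1)) * (1 / (a + 1) ^ 2) := by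
    have : 1 / (a + 1) ^ 2 = Real.exp (-(2 * Real.log (a + 1))) := by
      rw [Real.exp_neg, two_mul, Real.exp_add, Real.exp_log (by linarith)]
      field_simp
    rw [this, ← Real.exp_add]; ring_nf
  rw [e]
  gcongr
  rw [div_sub_div _ _ ha0.ne' (by linarith), div_le_div_iff₀ (by positivity) (by positivity)]
  nlinarith

theorem Iw_pos {a : ℝ} (ha : 1 ≤ a) : 0 < Iw (-a + 3) := (Real.exp_pos _).trans_le (le_Iw ha)

theorem log_Iw_le {a : ℝ} (ha : 1 ≤ a) : Real.log (Iw (-a + 3)) ≤ a * Real.log a - a :=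
  (Real.log_le_iff_le_exp (Iw_pos ha)).2 (Iw_le (by linarith))

theorem le_log_Iw {a : ℝ} (ha : 1 ≤ a) :
    a * Real.log a - a - 1 - 5 * Real.log (a + 1) ≤ Real.log (Iw (-a + 3)) :=
  (Real.le_log_iff_exp_le (Iw_pos ha)).2 (le_Iw ha)

theorem log_le_mul_sub_one_sub_log {ε y : ℝ} (hε : 0 < ε) (hy : 0 < y) :
    Real.log y ≤ ε * y - 1 - Real.log ε := by
  have h := Real.log_le_sub_one_of_pos (mul_pos hε hy)
  rw [Real.log_mul hε.ne' hy.ne'] at h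
  linarith

theorem growth_rate_pos {j p : ℝ} (hj : 1 < j) (hp : 2 + 2 / j < p) :
    0 < 2 * j * Real.log (2 * j) + (j + 1) * Real.log ((j + 1) * p)
      - 2 * (j + 1) * Real.log (2 * (j + 1)) - (j - 1) * Real.log ((j - 1) * p) := by
  have hj0 : 0 < j := by linarith
  have hj1 : 0 < j - 1 := by linarith
  have hp0 : 0 < p := lt_trans (by positivity) hp
  rw [Real.log_mul two_ne_zero hj0.ne', Real.log_mul (by positivity) hp0.ne',
    Real.log_mul two_ne_zero (by positivity), Real.log_mul hj1.ne' hp0.ne']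
  have h1 : Real.log 2 + Real.log (j + 1) - Real.log j < Real.log p := by
    rw [← Real.log_mul (by norm_num) (by positivity), ← Real.log_div (by positivity) hj0.ne']
    refine Real.log_lt_log (by positivity) (lt_of_eq_of_lt ?_ hp)
    field_simp
  have h2 : Real.log (j + 1) + Real.log (j - 1) < 2 * Real.log j := by
    rw [← Real.log_mul (by positivity) hj1.ne', two_mul, ← Real.log_mul hj0.ne' hj0.ne']
    exact Real.log_lt_log (by positivity) (by nlinarith)
  nlinarith [mul_pos hj1 (sub_pos.2 h2)]

/-- For `j ≥ 2` and `p > 2 + 2/j`, the ratio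
`[I(-2jk+3)]^p · I(-(j+1)pk+3) / ([I(-2(j+1)k+3)]^p · I(-(j-1)pk+3))` blows up as `k → ∞`. -/
theorem ratio_blowup_lambda_tilde (j : ℕ) (hj : 2 ≤ j) (p : ℝ) (hp : 2 + 2/(j:ℝ) < p) :
    Tendsto (fun k : ℕ =>
        (Iw (-(2*(j:ℝ)*k) + 3)) ^ p * Iw (-(((j:ℝ)+1)*p*k) + 3) /
          ((Iw (-(2*((j:ℝ)+1)*k) + 3)) ^ p * Iw (-((((j:ℝ)-1))*p*k) + 3)))
      atTop atTop := by
  have hj' : (2 : ℝ) ≤ j := by exact_mod_cast hj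
  generalize (j : ℝ) = x at hj' hp ⊢
  have hp2 : 2 < p := lt_trans (by linarith [show 0 < 2 / x by positivity]) hp
  have hδ := growth_rate_pos (by linarith) hp
  set δ := 2 * x * Real.log (2 * x) + (x + 1) * Real.log ((x + 1) * p)
      - 2 * (x + 1) * Real.log (2 * (x + 1)) - (x - 1) * Real.log ((x - 1) * p) with hδ_def
  obtain ⟨ε, hε, hεδ⟩ : ∃ ε, 0 < ε ∧ ε * (30 * (x + 1)) = δ :=
    ⟨δ / (30 * (x + 1)), by positivity, by field_simp⟩
  have hlim : Tendsto (fun k : ℕ => p * δ / 2 * (k : ℝ) +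
      (-(1 + p) - 5 * (p + 1) * (ε - 1 - Real.log ε))) atTop atTop :=
    tendsto_atTop_add_const_right _ _
      (tendsto_natCast_atTop_atTop.const_mul_atTop (by positivity))
  refine tendsto_atTop_mono' _ ?_ (Real.tendsto_exp_atTop.comp hlim)
  filter_upwards [eventually_ge_atTop 1] with k hk
  have hk1 : (1 : ℝ) ≤ k := by exact_mod_cast hk
  simp only [Function.comp_apply]
  generalize (k : ℝ) = y at hk1 ⊢
  have b1 : 1 ≤ 2 * x * y := by nlinarith
  have b2 : 1 ≤ (x + 1) * p * y := by
    nlinarith [mul_nonneg (by linarith : 0 ≤ x) (by linarith : 0 ≤ p)]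
  have b3 : 1 ≤ 2 * (x + 1) * y := by nlinarith
  have hq1 : 1 ≤ (x - 1) * p := by nlinarith
  have hq : (x - 1) * p ≠ 0 := (zero_lt_one.trans_le hq1).ne'
  have b4 : 1 ≤ (x - 1) * p * y := by nlinarith
  have p1 := Iw_pos b1
  have p2 := Iw_pos b2
  have p3 := Iw_pos b3
  have p4 := Iw_pos b4
  rw [← Real.le_log_iff_exp_le (by positivity), Real.log_div (by positivity) (by positivity),
    Real.log_mul (by positivity) p2.ne', Real.log_mul (by positivity) p4.ne',
    Real.log_rpow p1, Real.log_rpow p3]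
  have hp0 : 0 ≤ p := by linarith
  have l1 := mul_le_mul_of_nonneg_left (le_log_Iw b1) hp0
  have l2 := le_log_Iw b2
  have l3 := mul_le_mul_of_nonneg_left (log_Iw_le b3) hp0
  have l4 := log_Iw_le b4
  have g1 := mul_le_mul_of_nonneg_left
    (log_le_mul_sub_one_sub_log hε (show 0 < 2 * x * y + 1 by linarith)) hp0
  have g2 := log_le_mul_sub_one_sub_log hε (show 0 < (x + 1) * p * y + 1 by linarith)
  have hy : y ≠ 0 := by positivity
  have hmain : p * (2 * x * y * Real.log (2 * x * y) - 2 * x * y)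
      + ((x + 1) * p * y * Real.log ((x + 1) * p * y) - (x + 1) * p * y)
      - p * (2 * (x + 1) * y * Real.log (2 * (x + 1) * y) - 2 * (x + 1) * y)
      - ((x - 1) * p * y * Real.log ((x - 1) * p * y) - (x - 1) * p * y) = p * δ * y := by
    rw [Real.log_mul (by positivity) hy, Real.log_mul (by positivity) hy,
      Real.log_mul (by positivity) hy, Real.log_mul hq hy, hδ_def]
    ring
  have hεy : p * ε * y * (15 * x + 5) ≤ p * δ / 2 * y := by
    rw [← hεδ]
    have : 0 ≤ p * ε * y := by positivity
    nlinarith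
  nlinarith
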